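/- For every real x with 0 < x < 1, 1 + ∑_{n=1}^∞ x^n/(1−x^{2n}) < ∏_{n=1}^∞ (1+x^n) − x^4/((1−x^2)(1−x^4)) − ∑_{k∈P} ( x^k/((1−x^2)(1−x^{2(k−1)})) − x^k/(1−x^{2k}) ), where P is the set of integers greater than 2 that are prime powers, i.e., P = { p^r : p prime, r ≥ 1, p^r > 2 }. -/

import Mathlib

open Filter Topology Finset

/-- The partial sum `∑_{n < N} z ^ n / ((1 - q) ⋯ (1 - q ^ n))` of Euler's `q`-series. -/
noncomputable def eulerPartialSum (q : ℝ) (N : ℕ) (z : ℝ) : ℝ :=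
  ∑ n ∈ range N, z ^ n / ∏ j ∈ range n, (1 - q ^ (j + 1))

lemma one_sub_pow_succ_pos {q : ℝ} (hq0 : 0 ≤ q) (hq1 : q < 1) (j : ℕ) : 0 < 1 - q ^ (j + 1) :=
  sub_pos.2 (pow_lt_one₀ hq0 hq1 j.succ_ne_zero)

lemma prod_one_sub_pow_succ_pos {q : ℝ} (hq0 : 0 ≤ q) (hq1 : q < 1) (s : Finset ℕ) :
    0 < ∏ j ∈ s, (1 - q ^ (j + 1)) :=
  prod_pos fun j _ => one_sub_pow_succ_pos hq0 hq1 j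

lemma eulerPartialSum_sub {q : ℝ} (hq0 : 0 ≤ q) (hq1 : q < 1) (N : ℕ) (z : ℝ) :
    eulerPartialSum q (N + 1) z - eulerPartialSum q (N + 1) (z * q) =
      z * eulerPartialSum q N z := by
  induction N with
  | zero => simp [eulerPartialSum]
  | succ N ih =>
    have h1 := (one_sub_pow_succ_pos hq0 hq1 N).ne'
    have h2 := (prod_one_sub_pow_succ_pos hq0 hq1 (range N)).ne'
    have e (M : ℕ) (w : ℝ) : eulerPartialSum q (M + 1) w =
        eulerPartialSum q M w + w ^ M / ∏ j ∈ range M, (1 - q ^ (j + 1)) :=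
      sum_range_succ _ _
    have key : z ^ (N + 1) / (∏ j ∈ range (N + 1), (1 - q ^ (j + 1))) -
        (z * q) ^ (N + 1) / (∏ j ∈ range (N + 1), (1 - q ^ (j + 1))) =
        z * (z ^ N / ∏ j ∈ range N, (1 - q ^ (j + 1))) := by
      rw [prod_range_succ]
      field_simp
      ring
    rw [e (N + 1) z, e (N + 1) (z * q), e N z, mul_add, ← ih, ← key, e N z]
    ring

lemma eulerPartialSum_mul_one_sub_le {q z : ℝ} (hq0 : 0 ≤ q) (hq1 : q < 1) (hz : 0 ≤ z) (N : ℕ) :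
    eulerPartialSum q (N + 1) z * (1 - z) ≤ eulerPartialSum q (N + 1) (z * q) := by
  have h := eulerPartialSum_sub hq0 hq1 N z
  have hle : eulerPartialSum q N z ≤ eulerPartialSum q (N + 1) z := by
    rw [eulerPartialSum, eulerPartialSum, sum_range_succ]
    have := (prod_one_sub_pow_succ_pos hq0 hq1 (range N)).le
    exact le_add_of_nonneg_right (by positivity)
  nlinarith [mul_le_mul_of_nonneg_left hle hz]

lemma eulerPartialSum_mul_prod_le {q z : ℝ} (hq0 : 0 ≤ q) (hq1 : q < 1) (hz0 : 0 ≤ z)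
    (hz1 : z ≤ 1) (N M : ℕ) :
    eulerPartialSum q (N + 1) z * ∏ j ∈ range M, (1 - z * q ^ j) ≤
      eulerPartialSum q (N + 1) (z * q ^ M) := by
  induction M with
  | zero => simp
  | succ M ih =>
    have hle : z * q ^ M ≤ 1 := mul_le_one₀ hz1 (by positivity) (pow_le_one₀ hq0 hq1.le)
    calc _ = (eulerPartialSum q (N + 1) z * ∏ j ∈ range M, (1 - z * q ^ j)) *
          (1 - z * q ^ M) := by rw [prod_range_succ, mul_assoc]
      _ ≤ eulerPartialSum q (N + 1) (z * q ^ M) * (1 - z * q ^ M) := by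
          gcongr
      _ ≤ eulerPartialSum q (N + 1) (z * q ^ M * q) :=
          eulerPartialSum_mul_one_sub_le hq0 hq1 (by positivity) N
      _ = _ := by rw [pow_succ, mul_assoc]

lemma prod_one_add_pow_mul_prod_odd (x : ℝ) (M : ℕ) :
    (∏ n ∈ range (2 * M), (1 + x ^ (n + 1))) * (∏ j ∈ range M, (1 - x * (x ^ 2) ^ j)) *
      ∏ j ∈ range M, (1 - (x ^ 2) ^ (j + 1)) = ∏ j ∈ range (2 * M), (1 - (x ^ 2) ^ (j + 1)) := by
  induction M with
  | zero => simp
  | succ M ih =>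
    rw [show 2 * (M + 1) = 2 * M + 1 + 1 by ring]
    simp only [prod_range_succ]
    rw [← ih]
    ring

lemma one_sub_le_prod_one_add_pow_mul_prod_odd {x : ℝ} (hx0 : 0 ≤ x) (hx1 : x < 1) (M : ℕ) :
    1 - M * (x ^ 2) ^ M ≤
      (∏ n ∈ range (2 * M), (1 + x ^ (n + 1))) * ∏ j ∈ range M, (1 - x * (x ^ 2) ^ j) := by
  have hq1 : x ^ 2 < 1 := pow_lt_one₀ hx0 hx1 two_ne_zero
  have hpos := prod_one_sub_pow_succ_pos (sq_nonneg x) hq1 (range M)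
  have h := prod_one_add_pow_mul_prod_odd x M
  rw [two_mul M, prod_range_add (fun j => 1 - (x ^ 2) ^ (j + 1)),
    mul_comm (∏ j ∈ range M, (1 - (x ^ 2) ^ (j + 1)))] at h
  rw [two_mul, mul_right_cancel₀ hpos.ne' h]
  have hM1 : (x ^ 2) ^ M ≤ 1 := pow_le_one₀ (sq_nonneg x) hq1.le
  calc 1 - M * (x ^ 2) ^ M = 1 + M * (-(x ^ 2) ^ M) := by ring
    _ ≤ (1 + -(x ^ 2) ^ M) ^ M := one_add_mul_le_pow (by linarith) M
    _ = ∏ _j ∈ range M, (1 - (x ^ 2) ^ M) := by simp [sub_eq_add_neg]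
    _ ≤ _ := by
      refine prod_le_prod (fun _ _ => by linarith) fun j _ => ?_
      have : (x ^ 2) ^ (M + j + 1) ≤ (x ^ 2) ^ M :=
        pow_le_pow_of_le_one (sq_nonneg x) hq1.le (by omega)
      linarith

lemma eulerPartialSum_le_tprod {x : ℝ} (hx0 : 0 ≤ x) (hx1 : x < 1) (N : ℕ) :
    eulerPartialSum (x ^ 2) (N + 1) x ≤ ∏' n : ℕ, (1 + x ^ (n + 1)) := by
  have hq1 : x ^ 2 < 1 := pow_lt_one₀ hx0 hx1 two_ne_zero
  have hnn : 0 ≤ eulerPartialSum (x ^ 2) (N + 1) x := sum_nonneg fun n _ =>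
    div_nonneg (by positivity) (prod_one_sub_pow_succ_pos (sq_nonneg x) hq1 _).le
  have hmul : Multipliable fun n : ℕ => 1 + x ^ (n + 1) :=
    Real.multipliable_one_add_of_summable
      ((summable_nat_add_iff 1).2 (summable_geometric_of_lt_one hx0 hx1))
  have hP : Tendsto (fun M : ℕ => ∏ n ∈ range (2 * M), (1 + x ^ (n + 1))) atTop
      (𝓝 (∏' n : ℕ, (1 + x ^ (n + 1)))) :=
    hmul.hasProd.tendsto_prod_nat.comp (tendsto_id.const_mul_atTop' two_pos)
  have hG : Tendsto (fun M : ℕ => eulerPartialSum (x ^ 2) (N + 1) (x * (x ^ 2) ^ M)) atTop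
      (𝓝 1) := by
    have hc : Continuous (eulerPartialSum (x ^ 2) (N + 1)) := by
      unfold eulerPartialSum
      fun_prop
    have h0 : eulerPartialSum (x ^ 2) (N + 1) (x * 0) = 1 := by
      simp [eulerPartialSum, sum_range_succ']
    rw [← h0]
    exact (hc.tendsto _).comp
      ((tendsto_pow_atTop_nhds_zero_of_lt_one (sq_nonneg x) hq1).const_mul x)
  have hB : Tendsto (fun M : ℕ => 1 - (M : ℝ) * (x ^ 2) ^ M) atTop (𝓝 1) := by
    simpa using (tendsto_self_mul_const_pow_of_lt_one (sq_nonneg x) hq1).const_sub 1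
  have hlim := le_of_tendsto_of_tendsto' (hB.const_mul (eulerPartialSum (x ^ 2) (N + 1) x))
    (hP.mul hG) fun M => ?_
  · simpa using hlim
  · have hP0 : 0 ≤ ∏ n ∈ range (2 * M), (1 + x ^ (n + 1)) := prod_nonneg fun _ _ => by positivity
    calc _ ≤ eulerPartialSum (x ^ 2) (N + 1) x * ((∏ n ∈ range (2 * M), (1 + x ^ (n + 1))) *
          ∏ j ∈ range M, (1 - x * (x ^ 2) ^ j)) :=
          mul_le_mul_of_nonneg_left (one_sub_le_prod_one_add_pow_mul_prod_odd hx0 hx1 M) hnn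
      _ = (∏ n ∈ range (2 * M), (1 + x ^ (n + 1))) *
          (eulerPartialSum (x ^ 2) (N + 1) x * ∏ j ∈ range M, (1 - x * (x ^ 2) ^ j)) := by ring
      _ ≤ _ := mul_le_mul_of_nonneg_left
          (eulerPartialSum_mul_prod_le (sq_nonneg x) hq1 hx0 hx1.le N M) hP0

/-- The term `x ^ n / ((1 - x ^ 2) ⋯ (1 - x ^ (2 * n)))` of Euler's series. -/
noncomputable def eulerTerm (x : ℝ) (n : ℕ) : ℝ :=
  x ^ n / ∏ j ∈ range n, (1 - (x ^ 2) ^ (j + 1))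

lemma eulerTerm_nonneg {x : ℝ} (hx0 : 0 ≤ x) (hx1 : x < 1) (n : ℕ) : 0 ≤ eulerTerm x n :=
  div_nonneg (by positivity) (prod_one_sub_pow_succ_pos (sq_nonneg x)
    (pow_lt_one₀ hx0 hx1 two_ne_zero) _).le

lemma sum_eulerTerm_le {x : ℝ} (hx0 : 0 ≤ x) (hx1 : x < 1) (N : ℕ) :
    ∑ n ∈ range N, eulerTerm x n ≤ ∏' n : ℕ, (1 + x ^ (n + 1)) := by
  refine le_trans ?_ (eulerPartialSum_le_tprod hx0 hx1 N)
  exact sum_le_sum_of_subset_of_nonneg (range_mono N.le_succ)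
    fun n _ _ => eulerTerm_nonneg hx0 hx1 n

lemma summable_eulerTerm {x : ℝ} (hx0 : 0 ≤ x) (hx1 : x < 1) : Summable (eulerTerm x) :=
  summable_of_sum_range_le (eulerTerm_nonneg hx0 hx1) (sum_eulerTerm_le hx0 hx1)

lemma one_add_tsum_eulerTerm_le {x : ℝ} (hx0 : 0 ≤ x) (hx1 : x < 1) :
    1 + ∑' n : ℕ, eulerTerm x (n + 1) ≤ ∏' n : ℕ, (1 + x ^ (n + 1)) := by
  have h := (summable_eulerTerm hx0 hx1).tsum_eq_zero_add
  rw [show eulerTerm x 0 = 1 by simp [eulerTerm]] at h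
  rw [← h]
  exact Real.tsum_le_of_sum_range_le (eulerTerm_nonneg hx0 hx1) (sum_eulerTerm_le hx0 hx1)

lemma div_prod_le_eulerTerm {x : ℝ} (hx0 : 0 ≤ x) (hx1 : x < 1) {n : ℕ} {s : Finset ℕ}
    (hs : s ⊆ range n) : x ^ n / ∏ j ∈ s, (1 - (x ^ 2) ^ (j + 1)) ≤ eulerTerm x n := by
  have hq1 : x ^ 2 < 1 := pow_lt_one₀ hx0 hx1 two_ne_zero
  have hpos := prod_one_sub_pow_succ_pos (sq_nonneg x) hq1 (range n)
  refine div_le_div_of_nonneg_left (by positivity) hpos ?_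
  rw [← prod_sdiff hs]
  refine mul_le_of_le_one_left (prod_one_sub_pow_succ_pos (sq_nonneg x) hq1 s).le ?_
  exact prod_le_one (fun j _ => (one_sub_pow_succ_pos (sq_nonneg x) hq1 j).le)
    fun j _ => sub_le_self _ (by positivity)

lemma div_one_sub_le_eulerTerm {x : ℝ} (hx0 : 0 ≤ x) (hx1 : x < 1) (n : ℕ) :
    x ^ (n + 1) / (1 - x ^ (2 * (n + 1))) ≤ eulerTerm x (n + 1) := by
  simpa [pow_mul] using div_prod_le_eulerTerm hx0 hx1 (n := n + 1) (s := {n}) (by simp)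

lemma div_mul_le_eulerTerm {x : ℝ} (hx0 : 0 ≤ x) (hx1 : x < 1) {n : ℕ} (hn : 2 ≤ n) :
    x ^ (n + 1) / ((1 - x ^ 2) * (1 - x ^ (2 * n))) ≤ eulerTerm x (n + 1) := by
  obtain ⟨m, rfl⟩ := Nat.exists_eq_add_of_le' hn
  have h := div_prod_le_eulerTerm hx0 hx1 (n := m + 2 + 1) (s := {0, m + 1})
    (by intro j; simp; omega)
  rw [prod_pair (by omega)] at h
  simpa [pow_mul] using h

theorem improved_lower_bound (x : ℝ) (hx0 : 0 < x) (hx1 : x < 1) :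
    1 + ∑' n : ℕ, x ^ (n + 1) / (1 - x ^ (2 * (n + 1))) <
      (∏' n : ℕ, (1 + x ^ (n + 1))) - x ^ 4 / ((1 - x ^ 2) * (1 - x ^ 4)) -
        ∑' k : {k : ℕ // IsPrimePow k ∧ 2 < k},
          (x ^ (k : ℕ) / ((1 - x ^ 2) * (1 - x ^ (2 * ((k : ℕ) - 1)))) -
            x ^ (k : ℕ) / (1 - x ^ (2 * (k : ℕ)))) := by
  set a : ℕ → ℝ := fun n => x ^ (n + 1) / (1 - x ^ (2 * (n + 1))) with ha
  set P : Set ℕ := {k | IsPrimePow k ∧ 2 < k}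
  set b : ℕ → ℝ := fun k => x ^ k / ((1 - x ^ 2) * (1 - x ^ (2 * (k - 1)))) -
    x ^ k / (1 - x ^ (2 * k)) with hb
  set e : ℝ := x ^ 4 / ((1 - x ^ 2) * (1 - x ^ 4)) with he
  have hpos (n : ℕ) (hn : n ≠ 0) : 0 < 1 - x ^ n := sub_pos.2 (pow_lt_one₀ hx0.le hx1 hn)
  have hs : Summable fun n => eulerTerm x (n + 1) :=
    (summable_nat_add_iff 1).2 (summable_eulerTerm hx0.le hx1)
  have ha0 (n : ℕ) : 0 ≤ a n := div_nonneg (by positivity) (hpos _ (by omega)).le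
  have hale (n : ℕ) : a n ≤ eulerTerm x (n + 1) := div_one_sub_le_eulerTerm hx0.le hx1 n
  have has : Summable a := hs.of_nonneg_of_le ha0 hale
  have hab (n : ℕ) : a n + b (n + 1) = x ^ (n + 1) / ((1 - x ^ 2) * (1 - x ^ (2 * n))) := by
    simp [ha, hb]
  have hab0 (n : ℕ) (hn : n + 1 ∈ P) : 0 ≤ a n + b (n + 1) := by
    rw [hab]
    have h2 : 2 < n + 1 := hn.2
    have := hpos 2 two_ne_zero
    have := hpos (2 * n) (by omega)
    positivity
  have hable (n : ℕ) (hn : n + 1 ∈ P) : a n + b (n + 1) ≤ eulerTerm x (n + 1) := by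
    rw [hab]
    exact div_mul_le_eulerTerm hx0.le hx1 (Nat.lt_succ_iff.1 hn.2)
  have hbs : Summable fun n => P.indicator b (n + 1) := by
    refine hs.of_norm_bounded fun n => ?_
    by_cases hn : n + 1 ∈ P
    · rw [Set.indicator_of_mem hn, Real.norm_eq_abs, abs_le]
      constructor <;> linarith [hab0 n hn, hable n hn, ha0 n, hale n]
    · rw [Set.indicator_of_notMem hn, norm_zero]
      exact (ha0 n).trans (hale n)
  have hbt : ∑' k : {k : ℕ // IsPrimePow k ∧ 2 < k}, b k = ∑' n, P.indicator b (n + 1) := by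
    have h0 : (0 : ℕ) ∉ P := fun h => absurd h.2 (by norm_num)
    calc ∑' k : {k : ℕ // IsPrimePow k ∧ 2 < k}, b k = ∑' k, P.indicator b k := tsum_subtype P b
      _ = _ := by
        rw [((summable_nat_add_iff 1).1 hbs).tsum_eq_zero_add, Set.indicator_of_notMem h0, zero_add]
  have hes : HasSum (fun n : ℕ => if n = 1 then e else 0) e := hasSum_ite_eq 1 e
  have hlt : ∑' n, (a n + P.indicator b (n + 1) + if n = 1 then e else 0) <
      ∑' n, eulerTerm x (n + 1) := by
    refine Summable.tsum_lt_tsum (i := 2) (fun n => ?_) ?_ ((has.add hbs).add hes.summable) hs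
    · by_cases hn : n + 1 ∈ P
      · have h1 : n ≠ 1 := by
          rintro rfl
          exact absurd hn.2 (by norm_num)
        simpa [Set.indicator_of_mem hn, h1] using hable n hn
      · rw [Set.indicator_of_notMem hn, add_zero]
        by_cases h1 : n = 1
        · subst h1
          have h2 := (hpos 2 two_ne_zero).ne'
          have h4 := (hpos 4 four_ne_zero).ne'
          refine le_of_eq ?_
          simp only [ha, he, eulerTerm, prod_range_succ, prod_range_zero, if_true]
          norm_num [← pow_mul]
          field_simp
          ring
        · simpa [h1] using hale n
    · have h3 : 2 + 1 ∈ P := ⟨Nat.prime_three.isPrimePow, by norm_num⟩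
      rw [Set.indicator_of_mem h3, hab]
      have h2 := hpos 2 two_ne_zero
      have h4 := hpos 4 four_ne_zero
      have h6 := hpos 6 (by norm_num)
      simp only [eulerTerm, prod_range_succ, prod_range_zero]
      norm_num [← pow_mul]
      refine div_lt_div_of_pos_left (by positivity) (by positivity) ?_
      refine mul_lt_of_lt_one_right (by positivity) ?_
      linarith [pow_pos hx0 6]
  rw [(has.add hbs).tsum_add hes.summable, has.tsum_add hbs, hes.tsum_eq, ← hbt] at hlt
  linarith [one_add_tsum_eulerTerm_le hx0.le hx1]
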